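/- Let A ⊂ L^∞ be a norm-closed acceptance set, S an eligible asset, and X with X_0 > 0. If λ* := R_{A,S}(X) ∈ (0,1), then the position X_T^{λ*} = (1−λ*)X_T + λ*(X_0/S_0)S_T belongs to the topological boundary of A. -/

import Mathlib

open MeasureTheory

/-- The set of percentages making the combined position acceptable. -/
def IRset {Ω : Type*} [MeasurableSpace Ω] {μ : Measure Ω}
    (A : Set (Lp ℝ ⊤ μ)) (S0 X0 : ℝ) (ST XT : Lp ℝ ⊤ μ) : Set ℝ :=
  {l : ℝ | l ∈ Set.Icc (0 : ℝ) 1 ∧ (1 - l) • XT + l • ((X0 / S0) • ST) ∈ A}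

/-- The intrinsic risk measure. -/
noncomputable def IR {Ω : Type*} [MeasurableSpace Ω] {μ : Measure Ω}
    (A : Set (Lp ℝ ⊤ μ)) (S0 X0 : ℝ) (ST XT : Lp ℝ ⊤ μ) : ℝ :=
  sInf (IRset A S0 X0 ST XT)

theorem stmt9 {Ω : Type*} [MeasurableSpace Ω] (μ : Measure Ω) [IsProbabilityMeasure μ]
    (A : Set (Lp ℝ ⊤ μ)) (hne : A.Nonempty) (hproper : A ≠ Set.univ)
    (hmono : ∀ X ∈ A, ∀ Y : Lp ℝ ⊤ μ, X ≤ Y → Y ∈ A) (hclosed : IsClosed A)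
    (S0 : ℝ) (hS0 : 0 < S0) (ST : Lp ℝ ⊤ μ) (hSA : ST ∈ A) (hST : 0 ≤ ST)
    (X0 : ℝ) (hX0 : 0 < X0) (XT : Lp ℝ ⊤ μ)
    (hR : IR A S0 X0 ST XT ∈ Set.Ioo (0 : ℝ) 1) :
    (1 - IR A S0 X0 ST XT) • XT + IR A S0 X0 ST XT • ((X0 / S0) • ST) ∈ frontier A := by
  have hcont : Continuous (fun l : ℝ => (1 - l) • XT + l • ((X0 / S0) • ST)) := by fun_prop
  have hcl : IsClosed (IRset A S0 X0 ST XT) :=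
    isClosed_Icc.inter (hclosed.preimage hcont)
  have hbdd : BddBelow (IRset A S0 X0 ST XT) := ⟨0, fun l hl => hl.1.1⟩
  have hnon : (IRset A S0 X0 ST XT).Nonempty := by
    by_contra h
    rw [Set.not_nonempty_iff_eq_empty] at h
    have h0 := hR.1
    rw [IR, h, Real.sInf_empty] at h0
    exact lt_irrefl _ h0
  have hmem : IR A S0 X0 ST XT ∈ IRset A S0 X0 ST XT := hcl.csInf_mem hnon hbdd
  have hle : ∀ l ∈ IRset A S0 X0 ST XT, IR A S0 X0 ST XT ≤ l := fun l hl => csInf_le hbdd hl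
  generalize IR A S0 X0 ST XT = r at *
  refine ⟨subset_closure hmem.2, fun hint => ?_⟩
  have hopen := (isOpen_interior (s := A)).preimage hcont
  obtain ⟨e, he, hball⟩ := Metric.isOpen_iff.1 hopen r hint
  have hm : 0 < min (e / 2) r := lt_min (half_pos he) hR.1
  have h1 : min (e / 2) r ≤ e / 2 := min_le_left _ _
  have h2 : min (e / 2) r ≤ r := min_le_right _ _
  have hin : r - min (e / 2) r ∈ Metric.ball r e := by
    rw [Metric.mem_ball, Real.dist_eq, abs_lt]
    constructor <;> linarith
  have := hle _ ⟨⟨by linarith, by linarith [hR.2]⟩, interior_subset (hball hin)⟩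
  linarith
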